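/- Let ℓ ∈ ℕ be even, let Q be a quasi-interpolation operator induced by an even sequence Λ = (λ(j))_{|j|≤μ}, μ ≥ ℓ/2 - 1, and let u ⊂ {1,…,d}. Let 𝐤 ∈ ℤ≥0^d satisfy k_j > 0 for j ∈ u and k_j = 0 for j ∉ u. In the representation q_𝐤(f) = Σ_{𝐬∈I(𝐤)} c_{𝐤,𝐬}(f) N_{𝐤,𝐬} of the mixed operator q_𝐤 (with c_{𝐤,𝐬} = ∏_{j=1}^d c_{k_j,s_j} applied coordinatewise), the coefficients are given for every continuous f on 𝕋^d and every 𝐬 ∈ I(𝐤) by c_{𝐤,𝐬}(f) = T_{𝐡^{(𝐤)}}^{[P_{𝐤,𝐬}]}(f)(𝐬𝐡^{(𝐤)}), where P_{𝐤,𝐬}(𝐳) = ∏_{j∉u} P_Λ(z_j) · ∏_{j∈u} P*_{k_j,s_j}(z_j) · ∏_{j∈u} (z_j - 1)^ℓ, with P*_{k_j,s_j} = P*_even if s_j is even and P*_{k_j,s_j} = P*_odd if s_j is odd. In particular, c_{𝐤,𝐬}(f) is a fixed finite linear combination of values of the mixed ℓ-th difference Δ_{𝐡^{(𝐤)}}^{ℓ,u}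 f. -/

import Mathlib

open MeasureTheory Finset
open scoped ENNReal
noncomputable section

/-! Common definitions for Dinh Dũng, "B-spline quasi-interpolation sampling representation
and sampling recovery in Sobolev spaces of mixed smoothness". -/

/-- Cardinal B-spline of order `ℓ`: `M_1 = 1_{[0,1)}`, `M_ℓ = M_{ℓ-1} * M_1` (convolution). -/
noncomputable def bspline : ℕ → ℝ → ℝ
  | 0, _ => 0
  | 1, x => if 0 ≤ x ∧ x < 1 then 1 else 0
  | (n+2), x => ∫ t in (0:ℝ)..1, bspline (n+1) (x - t)

/-- `h^{(k)} = ℓ⁻¹ 2^{-k}`. -/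
noncomputable def hstep (ℓ k : ℕ) : ℝ := ((ℓ : ℝ))⁻¹ * ((2:ℝ) ^ k)⁻¹

/-- The univariate quasi-interpolation coefficient
`a_{k,s}(f) = Σ_{|j|≤μ} λ(j) f(h^{(k)}(s - j + ℓ/2))`. -/
noncomputable def acoef (ℓ μ : ℕ) (lam : ℤ → ℝ) (k : ℕ) (s : ℤ) (f : ℝ → ℝ) : ℝ :=
  ∑ j ∈ Finset.Icc (-(μ:ℤ)) (μ:ℤ), lam j * f (hstep ℓ k * ((s : ℝ) - (j : ℝ) + (ℓ : ℝ)/2))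

/-- The base quasi-interpolation operator `Q(f,x) = Σ_s Λ(f,s) M(x-s)`. -/
noncomputable def Qbase (ℓ μ : ℕ) (lam : ℤ → ℝ) (f : ℝ → ℝ) (x : ℝ) : ℝ :=
  ∑' s : ℤ, (∑ j ∈ Finset.Icc (-(μ:ℤ)) (μ:ℤ), lam j * f ((s:ℝ) - (j:ℝ) + (ℓ:ℝ)/2)) *
    bspline ℓ (x - (s:ℝ))

/-- The scaled operator `Q_k(f,x) = Σ_s a_{k,s}(f) M(ℓ2^k x - s)`. -/
noncomputable def Qk (ℓ μ : ℕ) (lam : ℤ → ℝ) (k : ℕ) (f : ℝ → ℝ) (x : ℝ) : ℝ :=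
  ∑' s : ℤ, acoef ℓ μ lam k s f * bspline ℓ ((ℓ:ℝ) * 2^k * x - (s:ℝ))

/-- The sequence `Λ` is even: `λ(-j) = λ(j)`. -/
def IsEvenSeq (lam : ℤ → ℝ) : Prop := ∀ j : ℤ, lam (-j) = lam j

/-- `Q` is a quasi-interpolation operator: it reproduces all polynomials of degree `≤ ℓ-1`. -/
def IsQuasiInterp (ℓ μ : ℕ) (lam : ℤ → ℝ) : Prop :=
  ∀ g : Polynomial ℝ, g.degree < (ℓ : WithBot ℕ) →
    ∀ x : ℝ, Qbase ℓ μ lam (fun y => Polynomial.eval y g) x = Polynomial.eval x g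

/-- `N_k`: the 1-periodic extension of `M(ℓ2^k ·)`. -/
noncomputable def Nper (ℓ k : ℕ) (x : ℝ) : ℝ := ∑' n : ℤ, bspline ℓ ((ℓ:ℝ) * 2^k * (x - (n:ℝ)))

/-- `N_{k,s}(x) = N_k(x - h^{(k)} s)`. -/
noncomputable def Nks (ℓ k : ℕ) (s : ℤ) (x : ℝ) : ℝ := Nper ℓ k (x - hstep ℓ k * (s:ℝ))

/-- The coefficient of `z^s` in a Laurent polynomial. -/
noncomputable def lcoeff (P : LaurentPolynomial ℝ) (s : ℤ) : ℝ := (P.coeff : ℤ →₀ ℝ) s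

/-- The shift operator `T_h^{[P]}(f)(x) = Σ_s c_s f(x + s h)` generated by a Laurent
polynomial `P(z) = Σ_s c_s z^s`. -/
noncomputable def shiftOp (P : LaurentPolynomial ℝ) (h : ℝ) (f : ℝ → ℝ) (x : ℝ) : ℝ :=
  Finsupp.sum P.coeff fun s c => c * f (x + (s : ℝ) * h)

/-- The `ℓ`-th difference operator `Δ_h^ℓ f(x) = Σ_{j=0}^ℓ (-1)^{ℓ-j} C(ℓ,j) f(x+jh)`. -/
noncomputable def deltaOp (ℓ : ℕ) (h : ℝ) (f : ℝ → ℝ) (x : ℝ) : ℝ :=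
  ∑ j ∈ Finset.range (ℓ+1), (-1:ℝ)^(ℓ - j) * (ℓ.choose j : ℝ) * f (x + (j:ℝ) * h)

/-- The multivariate shift operator `T_𝐡^{[P]}` generated by the tensor-product Laurent
polynomial `P(𝐳) = ∏_j P_j(z_j)`. -/
noncomputable def tensorShift {d : ℕ} (P : Fin d → LaurentPolynomial ℝ) (h : Fin d → ℝ)
    (f : (Fin d → ℝ) → ℝ) (x : Fin d → ℝ) : ℝ :=
  ∑ s ∈ Fintype.piFinset (fun j => (((P j).coeff : ℤ →₀ ℝ)).support),
    (∏ j, lcoeff (P j) (s j)) * f (fun j => x j + (s j : ℝ) * h j)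

/-- `P_Λ(z) = z^{ℓ/2} Σ_{|s|≤μ} λ(s) z^s`. -/
noncomputable def PLam (ℓ μ : ℕ) (lam : ℤ → ℝ) : LaurentPolynomial ℝ :=
  ∑ s ∈ Finset.Icc (-(μ:ℤ)) (μ:ℤ),
    LaurentPolynomial.C (lam s) * LaurentPolynomial.T (s + (ℓ:ℤ)/2)

/-- `P_Λ(z²)`. -/
noncomputable def PLamSq (ℓ μ : ℕ) (lam : ℤ → ℝ) : LaurentPolynomial ℝ :=
  ∑ s ∈ Finset.Icc (-(μ:ℤ)) (μ:ℤ),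
    LaurentPolynomial.C (lam s) * LaurentPolynomial.T (2*(s + (ℓ:ℤ)/2))

/-- `P'_even(z) = 2^{-ℓ+1} P_Λ(z²) Σ_{j=0}^{ℓ/2} C(ℓ,2j) z^{-2j}`. -/
noncomputable def PevenAux (ℓ μ : ℕ) (lam : ℤ → ℝ) : LaurentPolynomial ℝ :=
  LaurentPolynomial.C ((2:ℝ) ^ (1 - (ℓ:ℤ))) * PLamSq ℓ μ lam *
    ∑ j ∈ Finset.range (ℓ/2 + 1),
      LaurentPolynomial.C ((ℓ.choose (2*j) : ℝ)) * LaurentPolynomial.T (-(2*(j:ℤ)))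

/-- `P'_odd(z) = 2^{-ℓ+1} P_Λ(z²) Σ_{j=0}^{ℓ/2-1} C(ℓ,2j+1) z^{-2j-1}`. -/
noncomputable def PoddAux (ℓ μ : ℕ) (lam : ℤ → ℝ) : LaurentPolynomial ℝ :=
  LaurentPolynomial.C ((2:ℝ) ^ (1 - (ℓ:ℤ))) * PLamSq ℓ μ lam *
    ∑ j ∈ Finset.range (ℓ/2),
      LaurentPolynomial.C ((ℓ.choose (2*j+1) : ℝ)) * LaurentPolynomial.T (-(2*(j:ℤ)) - 1)

/-- `P_even = P_Λ - P'_even`. -/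
noncomputable def Peven (ℓ μ : ℕ) (lam : ℤ → ℝ) : LaurentPolynomial ℝ :=
  PLam ℓ μ lam - PevenAux ℓ μ lam

/-- `P_odd = P_Λ - P'_odd`. -/
noncomputable def Podd (ℓ μ : ℕ) (lam : ℤ → ℝ) : LaurentPolynomial ℝ :=
  PLam ℓ μ lam - PoddAux ℓ μ lam

/-- A symmetric Laurent polynomial: its coefficients are symmetric about some
(possibly half-integer) center `c/2`. -/
def IsSymmLaurent (P : LaurentPolynomial ℝ) : Prop :=
  ∃ c : ℤ, ∀ s : ℤ, lcoeff P s = lcoeff P (c - s)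

/-- The unit cube `[0,1]^d`, a model of the torus `𝕋^d`. -/
def cube (d : ℕ) : Set (Fin d → ℝ) := Set.univ.pi fun _ => Set.Icc (0:ℝ) 1

/-- Lebesgue measure restricted to the unit cube. -/
noncomputable def μcube (d : ℕ) : Measure (Fin d → ℝ) := volume.restrict (cube d)

/-- `f` is 1-periodic in each variable, i.e. a function on the torus `𝕋^d`. -/
def PeriodicTd {d : ℕ} (f : (Fin d → ℝ) → ℝ) : Prop :=
  ∀ (x : Fin d → ℝ) (j : Fin d), f (Function.update x j (x j + 1)) = f x

/-- The univariate operator `Q_k` applied in the `j`-th variable. -/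
noncomputable def QkCoord (ℓ μ : ℕ) (lam : ℤ → ℝ) {d : ℕ} (j : Fin d) (k : ℕ)
    (f : (Fin d → ℝ) → ℝ) (x : Fin d → ℝ) : ℝ :=
  ∑' s : ℤ, (∑ i ∈ Finset.Icc (-(μ:ℤ)) (μ:ℤ), lam i *
      f (Function.update x j (hstep ℓ k * ((s:ℝ) - (i:ℝ) + (ℓ:ℝ)/2)))) *
    bspline ℓ ((ℓ:ℝ) * 2^k * x j - (s:ℝ))

/-- `Q_{k} - Q_{k-1}` in the `j`-th variable, with the convention `Q_{-1} = 0`. -/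
noncomputable def qdiffCoord (ℓ μ : ℕ) (lam : ℤ → ℝ) {d : ℕ} (j : Fin d) :
    ℕ → ((Fin d → ℝ) → ℝ) → (Fin d → ℝ) → ℝ
  | 0, f => QkCoord ℓ μ lam j 0 f
  | (k+1), f => fun x => QkCoord ℓ μ lam j (k+1) f x - QkCoord ℓ μ lam j k f x

/-- The mixed operator `Q_𝐤 = ∏_i Q_{k_i}`. -/
noncomputable def Qmix (ℓ μ : ℕ) (lam : ℤ → ℝ) {d : ℕ} (k : Fin d → ℕ)
    (f : (Fin d → ℝ) → ℝ) : (Fin d → ℝ) → ℝ :=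
  (List.finRange d).foldr (fun j g => QkCoord ℓ μ lam j (k j) g) f

/-- The mixed operator `q_𝐤 = ∏_i (Q_{k_i} - Q_{k_i-1})`. -/
noncomputable def qmix (ℓ μ : ℕ) (lam : ℤ → ℝ) {d : ℕ} (k : Fin d → ℕ)
    (f : (Fin d → ℝ) → ℝ) : (Fin d → ℝ) → ℝ :=
  (List.finRange d).foldr (fun j g => qdiffCoord ℓ μ lam j (k j) g) f

/-- The `𝐬`-th Fourier coefficient of a function on `𝕋^d`. -/
noncomputable def fourierCoeffCube (d : ℕ) (f : (Fin d → ℝ) → ℝ) (s : Fin d → ℤ) : ℂ :=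
  ∫ x in cube d, (f x : ℂ) *
    Complex.exp (-(2 * Real.pi * Complex.I) * (∑ j, (s j : ℂ) * (x j : ℂ)))

/-- `Σ_𝐬 f̂(𝐬) ∏_j (1+|s_j|²)^{r/2} e^{2πi(𝐬,x)}`. -/
noncomputable def WKernel (d : ℕ) (r : ℝ) (f : (Fin d → ℝ) → ℝ) (x : Fin d → ℝ) : ℂ :=
  ∑' s : Fin d → ℤ, fourierCoeffCube d f s * (((∏ j, ((1:ℝ) + (s j : ℝ)^2) ^ (r/2)) : ℝ) : ℂ) *
    Complex.exp ((2 * Real.pi * Complex.I) * (∑ j, (s j : ℂ) * (x j : ℂ)))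

/-- The norm of the Sobolev space `W^r_p` of mixed smoothness `r` on `𝕋^d`. -/
noncomputable def WNorm (d : ℕ) (r : ℝ) (p : ℝ≥0∞) (f : (Fin d → ℝ) → ℝ) : ℝ≥0∞ :=
  eLpNorm (WKernel d r f) p (μcube d)

/-- The Littlewood–Paley square function `(Σ_𝐤 |2^{r|𝐤|₁} q_𝐤(f)|²)^{1/2}`. -/
noncomputable def lpSqFn (d ℓ μ : ℕ) (lam : ℤ → ℝ) (r : ℝ) (f : (Fin d → ℝ) → ℝ)
    (x : Fin d → ℝ) : ℝ :=
  Real.sqrt (∑' k : Fin d → ℕ, ((2:ℝ) ^ (r * ∑ j, (k j : ℝ)) * qmix ℓ μ lam k f x) ^ 2)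

/-- The Smolyak-type sampling operator `R_m(f) = Σ_{|𝐤|₁ ≤ m} q_𝐤(f)`. -/
noncomputable def Rop (ℓ μ : ℕ) (lam : ℤ → ℝ) {d : ℕ} (m : ℕ) (f : (Fin d → ℝ) → ℝ)
    (x : Fin d → ℝ) : ℝ :=
  ∑ k ∈ (Fintype.piFinset fun _ : Fin d => Finset.range (m+1)).filter
      (fun k => ∑ j, k j ≤ m), qmix ℓ μ lam k f x

/-- The unit ball `U^r_p` of `W^r_p` (represented by continuous periodic functions). -/
def unitBallW (d : ℕ) (r p : ℝ) : Set ((Fin d → ℝ) → ℝ) :=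
  {f | Continuous f ∧ PeriodicTd f ∧ WNorm d r (ENNReal.ofReal p) f ≤ 1}

/-- The sampling width `r_n(F, L_q)`. -/
noncomputable def sampWidth (d n : ℕ) (q : ℝ≥0∞) (F : Set ((Fin d → ℝ) → ℝ)) : ℝ≥0∞ :=
  ⨅ (X : Fin n → (Fin d → ℝ)) (Φ : Fin n → (Fin d → ℝ) → ℝ),
    ⨆ f ∈ F, eLpNorm (fun x => f x - ∑ j, f (X j) * Φ j x) q (μcube d)

/-- The Smolyak grid `G^d(m) = {2^{-𝐤}𝐬 : 𝐤 ∈ ℕ^d, |𝐤|₁ = m, 0 ≤ s_j ≤ 2^{k_j}-1}`. -/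
noncomputable def smolyakGrid (d m : ℕ) : Finset (Fin d → ℝ) := by
  classical
  exact ((Fintype.piFinset fun _ : Fin d => Finset.Icc 1 m).filter fun k => ∑ j, k j = m).biUnion
    fun k => (Fintype.piFinset fun j => Finset.range (2 ^ (k j))).image
      fun s => fun j => (s j : ℝ) / 2 ^ (k j)

/-- The Smolyak sampling width `r_n^s(F, L_q)`. -/
noncomputable def smolyakWidth (d n : ℕ) (q : ℝ≥0∞) (F : Set ((Fin d → ℝ) → ℝ)) : ℝ≥0∞ :=
  ⨅ (m : ℕ) (_ : (smolyakGrid d m).card ≤ n) (Φ : (Fin d → ℝ) → (Fin d → ℝ) → ℝ),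
    ⨆ f ∈ F, eLpNorm (fun x => f x - ∑ y ∈ smolyakGrid d m, f y * Φ y x) q (μcube d)

/-- The `a`-th difference in the `j`-th coordinate. -/
noncomputable def deltaCoord {d : ℕ} (a : ℕ) (j : Fin d) (t : ℝ)
    (f : (Fin d → ℝ) → ℝ) (x : Fin d → ℝ) : ℝ :=
  ∑ i ∈ Finset.range (a+1), (-1:ℝ)^(a - i) * (a.choose i : ℝ) *
    f (Function.update x j (x j + (i:ℝ) * t))

/-- The mixed `(a,u)`-th difference `Δ_𝐡^{a,u} = ∏_{i∈u} Δ_{h_i}^a`. -/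
noncomputable def mixedDelta {d : ℕ} (a : ℕ) (u : Finset (Fin d)) (h : Fin d → ℝ)
    (f : (Fin d → ℝ) → ℝ) : (Fin d → ℝ) → ℝ :=
  u.toList.foldr (fun j g => deltaCoord a j (h j) g) f

/-- The mixed modulus of smoothness `ω_a^u(f,𝐭)_p`. -/
noncomputable def besovModulus (d a : ℕ) (u : Finset (Fin d)) (p : ℝ≥0∞)
    (t : Fin d → ℝ) (f : (Fin d → ℝ) → ℝ) : ℝ≥0∞ :=
  ⨆ h : {h : Fin d → ℝ // ∀ i ∈ u, |h i| < t i}, eLpNorm (mixedDelta a u h.1 f) p (μcube d)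

/-- The Besov quasi-seminorm `|f|_{B^{r,u}_{p,θ}}`. -/
noncomputable def besovSemi (d a : ℕ) (p θ : ℝ≥0∞) (r : ℝ) (u : Finset (Fin d))
    (f : (Fin d → ℝ) → ℝ) : ℝ≥0∞ :=
  if θ = ⊤ then
    ⨆ (t : Fin d → ℝ) (_ : t ∈ cube d),
      (∏ i ∈ u, ENNReal.ofReal ((t i) ^ (-r))) * besovModulus d a u p t f
  else
    (∫⁻ t in cube d,
      ((∏ i ∈ u, ENNReal.ofReal ((t i) ^ (-r))) * besovModulus d a u p t f) ^ θ.toReal *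
        (∏ i ∈ u, ENNReal.ofReal (t i)⁻¹)) ^ (1/θ.toReal)

/-- The Besov quasi-norm `‖f‖_{B^r_{p,θ}} = Σ_{u⊂[d]} |f|_{B^{r,u}_{p,θ}}`. -/
noncomputable def besovNorm (d a : ℕ) (p θ : ℝ≥0∞) (r : ℝ)
    (f : (Fin d → ℝ) → ℝ) : ℝ≥0∞ :=
  ∑ u : Finset (Fin d), besovSemi d a p θ r u f

/-- The sequence quasi-norm `(Σ_𝐤 2^{r|𝐤|₁θ} ‖g_𝐤‖_p^θ)^{1/θ}` (sup when `θ = ∞`). -/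
noncomputable def seqNormB (d : ℕ) (p θ : ℝ≥0∞) (r : ℝ)
    (g : (Fin d → ℕ) → (Fin d → ℝ) → ℝ) : ℝ≥0∞ :=
  if θ = ⊤ then
    ⨆ k : Fin d → ℕ, ENNReal.ofReal ((2:ℝ) ^ (r * ∑ j, (k j : ℝ))) * eLpNorm (g k) p (μcube d)
  else
    (∑' k : Fin d → ℕ,
      (ENNReal.ofReal ((2:ℝ) ^ (r * ∑ j, (k j : ℝ))) * eLpNorm (g k) p (μcube d)) ^ θ.toReal) ^
      (1/θ.toReal)

/-- The B-spline sum `q_𝐤 = Σ_{𝐬 ∈ I(𝐤)} c_{𝐤,𝐬} N_{𝐤,𝐬}` with given coefficients. -/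
noncomputable def bsplineSeriesTerm (ℓ : ℕ) {d : ℕ} (c : (Fin d → ℕ) → (Fin d → ℕ) → ℝ)
    (k : Fin d → ℕ) (x : Fin d → ℝ) : ℝ :=
  ∑ s ∈ Fintype.piFinset (fun j => Finset.range (ℓ * 2 ^ (k j))),
    c k s * ∏ j, Nks ℓ (k j) (s j : ℤ) (x j)

open LaurentPolynomial in
theorem shiftOp_C_mul_T (c : ℝ) (n : ℤ) (h : ℝ) (f : ℝ → ℝ) (x : ℝ) :
    shiftOp (C c * T n) h f x = c * f (x + (n : ℝ) * h) := by
  rw [← single_eq_C_mul_T, shiftOp, AddMonoidAlgebra.coeff_single,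
    Finsupp.sum_single_index (by simp)]

theorem shiftOp_add (P Q : LaurentPolynomial ℝ) (h : ℝ) (f : ℝ → ℝ) (x : ℝ) :
    shiftOp (P + Q) h f x = shiftOp P h f x + shiftOp Q h f x := by
  rw [shiftOp, AddMonoidAlgebra.coeff_add,
    Finsupp.sum_add_index' (by simp) (fun _ _ _ => add_mul _ _ _)]
  rfl

/-- `P ↦ T_h^{[P]}(f)(x)` as an additive homomorphism. -/
def shiftOpHom (h : ℝ) (f : ℝ → ℝ) (x : ℝ) : LaurentPolynomial ℝ →+ ℝ where
  toFun P := shiftOp P h f x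
  map_zero' := by simp [shiftOp]
  map_add' P Q := shiftOp_add P Q h f x

theorem shiftOp_sub (P Q : LaurentPolynomial ℝ) (h : ℝ) (f : ℝ → ℝ) (x : ℝ) :
    shiftOp (P - Q) h f x = shiftOp P h f x - shiftOp Q h f x :=
  map_sub (shiftOpHom h f x) P Q

theorem shiftOp_sum {ι : Type*} (t : Finset ι) (P : ι → LaurentPolynomial ℝ) (h : ℝ)
    (f : ℝ → ℝ) (x : ℝ) :
    shiftOp (∑ i ∈ t, P i) h f x = ∑ i ∈ t, shiftOp (P i) h f x :=
  map_sum (shiftOpHom h f x) P t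

theorem shiftOp_periodic {f : ℝ → ℝ} {c : ℝ} (hf : Function.Periodic f c)
    (P : LaurentPolynomial ℝ) (h : ℝ) : Function.Periodic (shiftOp P h f) c := by
  intro x
  unfold shiftOp
  refine Finsupp.sum_congr fun s _ => ?_
  rw [add_right_comm, hf]

theorem Fintype.sum_piFinset_succ {α M : Type*} [DecidableEq α] [AddCommMonoid M] {d : ℕ}
    (t : Fin (d + 1) → Finset α) (F : (Fin (d + 1) → α) → M) :
    ∑ p ∈ Fintype.piFinset t, F p
      = ∑ a ∈ t 0, ∑ p ∈ Fintype.piFinset (fun j => t j.succ), F (Fin.cons a p) := by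
  rw [← Finset.sum_product']
  refine Finset.sum_nbij' (fun p => (p 0, fun j => p j.succ)) (fun q => Fin.cons q.1 q.2)
    ?_ ?_ ?_ ?_ ?_
  · intro p hp
    rw [Fintype.mem_piFinset] at hp
    simpa [Fintype.mem_piFinset] using ⟨hp 0, fun j => hp j.succ⟩
  · intro q hq
    simp only [Finset.mem_product, Fintype.mem_piFinset] at hq
    rw [Fintype.mem_piFinset]
    intro j
    refine Fin.cases ?_ (fun i => ?_) j
    · simpa using hq.1
    · simpa using hq.2 i
  · intro p _
    exact Fin.cons_self_tail p
  · intro q _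
    simp
  · intro p _
    exact congrArg F (Fin.cons_self_tail p).symm

theorem tensorShift_succ {d : ℕ} (P : Fin (d + 1) → LaurentPolynomial ℝ) (h : Fin (d + 1) → ℝ)
    (f : (Fin (d + 1) → ℝ) → ℝ) (x : Fin (d + 1) → ℝ) :
    tensorShift P h f x
      = shiftOp (P 0) (h 0) (fun t => tensorShift (fun j => P j.succ) (fun j => h j.succ)
          (fun z => f (Fin.cons t z)) (fun j => x j.succ)) (x 0) := by
  unfold tensorShift shiftOp Finsupp.sum
  rw [Fintype.sum_piFinset_succ]
  refine Finset.sum_congr rfl fun m _ => ?_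
  simp only [Finset.mul_sum]
  refine Finset.sum_congr rfl fun p _ => ?_
  rw [Fin.prod_univ_succ, ← mul_assoc]
  congr 1
  congr 1
  ext j
  refine Fin.cases ?_ (fun i => ?_) j <;> simp

/-- A sampling operator acting in the `j`-th variable: finite combination of the functions `W s`
with coefficients `T_h^{[P s]}` at the nodes `s h`. -/
def samplingCoord {d : ℕ} (n : ℕ) (P : ℕ → LaurentPolynomial ℝ) (h : ℝ) (W : ℕ → ℝ → ℝ)
    (j : Fin d) (g : (Fin d → ℝ) → ℝ) (x : Fin d → ℝ) : ℝ :=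
  ∑ s ∈ Finset.range n, shiftOp (P s) h (fun t => g (Function.update x j t)) ((s : ℝ) * h)
    * W s (x j)

theorem foldr_samplingCoord_cons {d : ℕ} (n : Fin (d + 1) → ℕ)
    (P : Fin (d + 1) → ℕ → LaurentPolynomial ℝ) (h : Fin (d + 1) → ℝ)
    (W : Fin (d + 1) → ℕ → ℝ → ℝ) (f : (Fin (d + 1) → ℝ) → ℝ) (a : ℝ) (l : List (Fin d))
    (z : Fin d → ℝ) :
    (l.map Fin.succ).foldr (fun j => samplingCoord (n j) (P j) (h j) (W j) j) f (Fin.cons a z)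
      = l.foldr (fun j => samplingCoord (n j.succ) (P j.succ) (h j.succ) (W j.succ) j)
          (fun y => f (Fin.cons a y)) z := by
  induction l generalizing z with
  | nil => rfl
  | cons i l ih =>
    simp only [List.map_cons, List.foldr_cons, samplingCoord, Fin.cons_succ, ← Fin.cons_update]
      at ih ⊢
    simp only [ih]

theorem foldr_samplingCoord {d : ℕ} (n : Fin d → ℕ) (P : Fin d → ℕ → LaurentPolynomial ℝ)
    (h : Fin d → ℝ) (W : Fin d → ℕ → ℝ → ℝ) (f : (Fin d → ℝ) → ℝ) (x : Fin d → ℝ) :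
    (List.finRange d).foldr (fun j => samplingCoord (n j) (P j) (h j) (W j) j) f x
      = ∑ s ∈ Fintype.piFinset (fun j => Finset.range (n j)),
          tensorShift (fun j => P j (s j)) h f (fun j => (s j : ℝ) * h j)
          * ∏ j, W j (s j) (x j) := by
  induction d with
  | zero =>
    simp only [List.finRange_zero, List.foldr_nil, tensorShift, Fintype.piFinset_of_isEmpty,
      Finset.univ_unique, Finset.sum_singleton, Finset.univ_eq_empty, Finset.prod_empty, one_mul,
      mul_one]
    exact congrArg f (Subsingleton.elim _ _)
  | succ d ih =>
    obtain ⟨a, z, rfl⟩ : ∃ a z, x = Fin.cons a z := ⟨x 0, Fin.tail x, (Fin.cons_self_tail x).symm⟩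
    rw [List.finRange_succ, List.foldr_cons, Fintype.sum_piFinset_succ]
    unfold samplingCoord
    refine Finset.sum_congr rfl fun s _ => ?_
    simp only [Fin.update_cons_zero]
    have key := fun t => foldr_samplingCoord_cons n P h W f t (List.finRange d) z
    unfold samplingCoord at key ih
    simp only [key, ih, tensorShift_succ, Fin.prod_univ_succ, Fin.cons_zero, Fin.cons_succ]
    simp only [shiftOp, Finsupp.sum, Finset.mul_sum, Finset.sum_mul]
    rw [Finset.sum_comm]
    refine Finset.sum_congr rfl fun p _ => Finset.sum_congr rfl fun m _ => ?_
    ring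

theorem samplingCoord_periodic {d : ℕ} (n : ℕ) (P : ℕ → LaurentPolynomial ℝ) (h : ℝ)
    (W : ℕ → ℝ → ℝ) {i j : Fin d} (hij : i ≠ j) {g : (Fin d → ℝ) → ℝ}
    (hg : ∀ x : Fin d → ℝ, g (Function.update x i (x i + 1)) = g x) (x : Fin d → ℝ) :
    samplingCoord n P h W j g (Function.update x i (x i + 1)) = samplingCoord n P h W j g x := by
  unfold samplingCoord
  have key : ∀ t, g (Function.update (Function.update x i (x i + 1)) j t)
      = g (Function.update x j t) := fun t => by
    rw [Function.update_comm hij]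
    simpa [Function.update_of_ne hij] using hg (Function.update x j t)
  simp only [key, Function.update_of_ne hij.symm]

/-- Coordinate operators that agree with sampling operators on functions periodic in that
coordinate may be replaced by them in a composition over distinct coordinates. -/
theorem foldr_eq_foldr_samplingCoord {d : ℕ} (n : Fin d → ℕ)
    (P : Fin d → ℕ → LaurentPolynomial ℝ) (h : Fin d → ℝ) (W : Fin d → ℕ → ℝ → ℝ)
    (A : Fin d → ((Fin d → ℝ) → ℝ) → (Fin d → ℝ) → ℝ)
    (hA : ∀ j g, (∀ x : Fin d → ℝ, g (Function.update x j (x j + 1)) = g x) →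
      A j g = samplingCoord (n j) (P j) (h j) (W j) j g)
    {f : (Fin d → ℝ) → ℝ} (hf : PeriodicTd f) {l : List (Fin d)} (hl : l.Nodup) :
    l.foldr A f = l.foldr (fun j => samplingCoord (n j) (P j) (h j) (W j) j) f ∧
      ∀ i ∉ l, ∀ x : Fin d → ℝ, l.foldr A f (Function.update x i (x i + 1)) = l.foldr A f x := by
  induction l with
  | nil => exact ⟨rfl, fun i _ x => hf x i⟩
  | cons j l ih =>
    rw [List.nodup_cons] at hl
    obtain ⟨h1, h2⟩ := ih hl.2
    have h3 := hA j _ (h2 j hl.1)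
    refine ⟨?_, fun i hi x => ?_⟩
    · rw [List.foldr_cons, List.foldr_cons, h3, h1]
    · rw [List.mem_cons, not_or] at hi
      rw [List.foldr_cons, h3]
      exact samplingCoord_periodic _ _ _ _ hi.1 (h2 i hi.2) x

theorem bspline_eq_zero (ℓ : ℕ) {x : ℝ} (hx : x < 0 ∨ (ℓ : ℝ) < x) : bspline ℓ x = 0 := by
  induction ℓ using Nat.twoStepInduction generalizing x with
  | zero => rfl
  | one =>
    rw [bspline, if_neg]
    rintro ⟨h0, h1⟩
    rcases hx with h | h
    · linarith
    · norm_num at h; linarith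
  | more n _ ih =>
    rw [bspline]
    refine intervalIntegral.integral_zero_ae (Filter.Eventually.of_forall fun t ht => ?_)
    rw [Set.uIoc_of_le zero_le_one] at ht
    apply ih
    rcases hx with h | h
    · left; linarith [ht.1]
    · right; push_cast at h ⊢; linarith [ht.2]

theorem bspline_succ_succ (n : ℕ) (x : ℝ) :
    bspline (n + 2) x = ∫ t in (x - 1)..x, bspline (n + 1) t := by
  rw [bspline, intervalIntegral.integral_comp_sub_left, sub_zero]

theorem intervalIntegrable_bspline (ℓ : ℕ) (a b : ℝ) :
    IntervalIntegrable (bspline ℓ) volume a b := by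
  induction ℓ using Nat.twoStepInduction generalizing a b with
  | zero => exact IntervalIntegrable.zero
  | one =>
    have : bspline 1 = (Set.Ico (0 : ℝ) 1).indicator (fun _ => (1 : ℝ)) := by
      ext x; simp [bspline, Set.indicator, Set.mem_Ico]
    rw [this]
    have hi : Integrable ((Set.Ico (0 : ℝ) 1).indicator (fun _ => (1 : ℝ))) volume :=
      (integrable_indicator_iff measurableSet_Ico).2 (by simp [integrableOn_const_iff])
    exact hi.intervalIntegrable
  | more n _ ih =>
    apply Continuous.intervalIntegrable
    have h := intervalIntegral.continuous_primitive ih 0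
    have he : bspline (n + 2) = fun x => (∫ t in (0 : ℝ)..x, bspline (n + 1) t)
        - ∫ t in (0 : ℝ)..(x - 1), bspline (n + 1) t := by
      ext x
      rw [bspline_succ_succ, intervalIntegral.integral_interval_sub_left (ih _ _) (ih _ _)]
    rw [he]
    exact h.sub (h.comp (continuous_id.sub continuous_const))

/-- The two-scale relation of the cardinal B-spline. -/
theorem bspline_refine (n : ℕ) (y : ℝ) :
    bspline (n + 1) y = ((2 : ℝ) ^ n)⁻¹ * ∑ j ∈ Finset.range (n + 2),
      ((n + 1).choose j : ℝ) * bspline (n + 1) (2 * y - j) := by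
  induction n generalizing y with
  | zero =>
    simp only [Finset.sum_range_succ, Finset.sum_range_zero, bspline]
    norm_num
    split_ifs <;> first | (exfalso; grind) | simp
  | succ n ih =>
    have hint : ∀ j : ℕ, ∫ t in (0 : ℝ)..1, bspline (n + 1) (2 * (y - t) - j)
        = 2⁻¹ * (bspline (n + 2) (2 * y - j) + bspline (n + 2) (2 * y - (j + 1 : ℕ))) := by
      intro j
      have h1 : ∀ t : ℝ, 2 * (y - t) - j = (2 * y - j) - 2 * t := fun t => by ring
      simp only [h1]
      rw [intervalIntegral.integral_comp_sub_mul (fun t => bspline (n + 1) t) two_ne_zero,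
        bspline_succ_succ, bspline_succ_succ, smul_eq_mul, add_comm,
        ← intervalIntegral.integral_add_adjacent_intervals (b := 2 * y - (j + 1 : ℕ))
          (intervalIntegrable_bspline _ _ _) (intervalIntegrable_bspline _ _ _)]
      push_cast
      ring_nf
    have hii : ∀ j ∈ Finset.range (n + 2), IntervalIntegrable
        (fun t => ((n + 1).choose j : ℝ) * bspline (n + 1) (2 * (y - t) - j)) volume 0 1 := by
      intro j _
      refine IntervalIntegrable.const_mul ?_ _
      have h1 : ∀ t : ℝ, 2 * (y - t) - j = (2 * y - j) - 2 * t := fun t => by ring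
      simp only [h1]
      convert ((intervalIntegrable_bspline (n + 1) (2 * y - j - 0) (2 * y - j - 2)).comp_sub_left
        (2 * y - j)).comp_mul_left (c := 2) using 1 <;> ring
    rw [bspline, funext fun t => ih (y - t), intervalIntegral.integral_const_mul, intervalIntegral.integral_finsetSum hii]
    simp only [intervalIntegral.integral_const_mul, hint]
    have hp : ∑ j ∈ Finset.range (n + 1 + 2),
          ((n + 1 + 1).choose j : ℝ) * bspline (n + 2) (2 * y - j)
        = ∑ j ∈ Finset.range (n + 2), ((n + 1).choose j : ℝ) *
          (bspline (n + 2) (2 * y - j) + bspline (n + 2) (2 * y - (j + 1 : ℕ))) := by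
      simp only [mul_add, Finset.sum_add_distrib]
      rw [Finset.sum_range_succ']
      simp only [Nat.choose_succ_succ' (n + 1), Nat.cast_add, add_mul, Finset.sum_add_distrib]
      rw [Finset.sum_range_succ' (fun j => ((n + 1).choose j : ℝ) * bspline (n + 2) (2 * y - j)),
        Finset.sum_range_succ (fun j => ((n + 1).choose (j + 1) : ℝ) * _)]
      simp
      ring
    rw [hp, pow_succ, mul_inv, Finset.mul_sum, Finset.mul_sum]
    refine Finset.sum_congr rfl fun j _ => ?_
    ring

theorem summable_mul_bspline (ℓ : ℕ) (b : ℤ → ℝ) (y : ℝ) :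
    Summable fun s : ℤ => b s * bspline ℓ (y - s) := by
  refine summable_of_hasFiniteSupport ((Set.finite_Icc ⌊y - ℓ⌋ ⌈y⌉).subset fun s hs => ?_)
  by_contra hn
  refine hs ?_
  simp only
  rw [bspline_eq_zero, mul_zero]
  rw [Set.mem_Icc, not_and_or, not_le, not_le] at hn
  rcases hn with h | h
  · right
    have := (Int.cast_lt (R := ℝ).2 h).trans_le (Int.floor_le _)
    linarith
  · left
    have := Int.ceil_lt_iff.1 h
    linarith

theorem tsum_int_periodic_mul (N : ℕ) [NeZero N] {b : ℤ → ℝ}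
    (hb : Function.Periodic b (N : ℤ)) {F : ℤ → ℝ} (hs : Summable fun s => b s * F s) :
    ∑' s : ℤ, b s * F s = ∑ r ∈ Finset.range N, b r * ∑' m : ℤ, F (r + N * m) := by
  rw [← (Int.divModEquiv N).symm.tsum_eq]
  have hs' := ((Int.divModEquiv N).symm.summable_iff).2 hs
  rw [← (Equiv.prodComm _ _).tsum_eq]
  have hs'' := ((Equiv.prodComm _ _).summable_iff).2 hs'
  refine (Summable.tsum_prod hs'').trans ?_
  rw [tsum_fintype, Finset.sum_range]
  refine Finset.sum_congr rfl fun r _ => ?_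
  rw [← tsum_mul_left]
  refine tsum_congr fun m => ?_
  have he : (Int.divModEquiv N).symm (m, r) = (r : ℤ) + N * m := by
    rw [Int.divModEquiv_symm_apply]; simp; ring
  simp only [Function.comp_apply, Equiv.prodComm_apply, Prod.swap_prod_mk, he]
  congr 1
  have := hb.int_mul m (r : ℤ)
  rwa [mul_comm, Int.cast_id] at this

theorem hstep_mul_cancel {ℓ : ℕ} (hℓ : 0 < ℓ) (k : ℕ) :
    ((ℓ * 2 ^ k : ℕ) : ℝ) * hstep ℓ k = 1 := by
  have : (ℓ : ℝ) ≠ 0 := by positivity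
  unfold hstep
  push_cast
  field_simp

theorem two_mul_hstep_succ (ℓ k : ℕ) : 2 * hstep ℓ (k + 1) = hstep ℓ k := by
  unfold hstep
  rw [pow_succ]
  field_simp

theorem Nks_eq_tsum {ℓ : ℕ} (hℓ : 0 < ℓ) (k r : ℕ) (y : ℝ) :
    Nks ℓ k (r : ℤ) y = ∑' m : ℤ,
      bspline ℓ ((ℓ : ℝ) * 2 ^ k * y - (((r : ℤ) + (ℓ * 2 ^ k : ℕ) * m : ℤ) : ℝ)) := by
  unfold Nks Nper
  refine tsum_congr fun m => congrArg _ ?_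
  have h := hstep_mul_cancel hℓ k
  push_cast at h ⊢
  linear_combination (-(r : ℝ)) * h

theorem tsum_periodic_mul_bspline {ℓ : ℕ} (hℓ : 0 < ℓ) (k : ℕ) {b : ℤ → ℝ}
    (hb : Function.Periodic b ((ℓ * 2 ^ k : ℕ) : ℤ)) (y : ℝ) :
    ∑' s : ℤ, b s * bspline ℓ ((ℓ : ℝ) * 2 ^ k * y - s)
      = ∑ r ∈ Finset.range (ℓ * 2 ^ k), b r * Nks ℓ k (r : ℤ) y := by
  have : NeZero (ℓ * 2 ^ k) := ⟨by positivity⟩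
  rw [tsum_int_periodic_mul (ℓ * 2 ^ k) hb (summable_mul_bspline ℓ b _)]
  refine Finset.sum_congr rfl fun r _ => ?_
  rw [Nks_eq_tsum hℓ]

theorem acoef_eq_shiftOp {ℓ μ : ℕ} (hℓe : Even ℓ) {lam : ℤ → ℝ} (hlam : IsEvenSeq lam) (k : ℕ)
    (s : ℤ) (φ : ℝ → ℝ) :
    acoef ℓ μ lam k s φ = shiftOp (PLam ℓ μ lam) (hstep ℓ k) φ (s * hstep ℓ k) := by
  obtain ⟨m, rfl⟩ := hℓe
  rw [acoef, PLam, shiftOp_sum]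
  simp only [shiftOp_C_mul_T]
  refine Finset.sum_nbij' (fun j => -j) (fun j => -j) ?_ ?_ ?_ ?_ ?_
  · intro j hj; rw [Finset.mem_Icc] at hj ⊢; omega
  · intro j hj; rw [Finset.mem_Icc] at hj ⊢; omega
  · intro j _; simp
  · intro j _; simp
  · intro j _
    have hm : (((m + m : ℕ) : ℤ) / 2) = m := by omega
    rw [hlam, hm]
    congr 2
    push_cast
    ring

theorem sum_range_even_add_odd (F : ℕ → ℝ) (m : ℕ) :
    ∑ j ∈ Finset.range (2 * m + 1), F j
      = ∑ i ∈ Finset.range (m + 1), F (2 * i) + ∑ i ∈ Finset.range m, F (2 * i + 1) := by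
  induction m with
  | zero => simp
  | succ m ih =>
    rw [show 2 * (m + 1) + 1 = 2 * m + 1 + 1 + 1 by ring, Finset.sum_range_succ,
      Finset.sum_range_succ, ih, Finset.sum_range_succ _ (m + 1),
      Finset.sum_range_succ (fun i => F (2 * i + 1)) m,
      show 2 * (m + 1) = 2 * m + 1 + 1 by ring]
    ring

/-- The coefficient of `M(2y - s)` in `Σ_r a_r M(y - r)` after applying the two-scale relation. -/
def refinedCoef (ℓ : ℕ) (a : ℤ → ℝ) (s : ℤ) : ℝ :=
  ((2 : ℝ) ^ (ℓ - 1))⁻¹ * ∑ j ∈ Finset.range (ℓ + 1),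
    (ℓ.choose j : ℝ) * if Even (s - (j : ℤ)) then a ((s - j) / 2) else 0

theorem tsum_refine {ℓ : ℕ} (hℓ : 0 < ℓ) (a : ℤ → ℝ) (y : ℝ) :
    ∑' s : ℤ, a s * bspline ℓ (y - s) = ∑' s : ℤ, refinedCoef ℓ a s * bspline ℓ (2 * y - s) := by
  obtain ⟨n, rfl⟩ := Nat.exists_eq_add_of_lt hℓ
  rw [zero_add]
  let g : ℕ → ℤ → ℝ := fun j s => if Even (s - (j : ℤ)) then a ((s - j) / 2) else 0
  have hinj : ∀ j : ℕ, Function.Injective (fun s : ℤ => 2 * s + j) := fun j s t h => by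
    simp only at h; omega
  have hgj : ∀ (j : ℕ) (s : ℤ), g j (2 * s + j) = a s := fun j s => by
    simp only [g, add_sub_cancel_right]
    rw [if_pos (even_two_mul s)]
    congr 1; omega
  have hsupp : ∀ j : ℕ, Function.support (fun s : ℤ => g j s * bspline (n + 1) (2 * y - s))
      ⊆ Set.range (fun s : ℤ => 2 * s + j) := by
    intro j s hs
    have hg : g j s ≠ 0 := left_ne_zero_of_mul hs
    have he : Even (s - (j : ℤ)) := by
      by_contra hn
      exact hg (if_neg hn)
    obtain ⟨t, ht⟩ := he
    exact ⟨t, by simp only; omega⟩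
  have hj : ∀ j : ℕ, ∑' s : ℤ, g j s * bspline (n + 1) (2 * y - s)
      = ∑' s : ℤ, a s * bspline (n + 1) (2 * (y - s) - j) := fun j => by
    rw [← (hinj j).tsum_eq (hsupp j)]
    refine tsum_congr fun s => ?_
    rw [hgj]
    congr 2
    push_cast
    ring
  have hs' : ∀ j : ℕ, Summable fun s : ℤ => a s * bspline (n + 1) (2 * (y - s) - j) := fun j => by
    have := ((summable_mul_bspline (n + 1) (g j) (2 * y)).comp_injective (hinj j))
    refine this.congr fun s => ?_
    simp only [Function.comp_apply, hgj]
    congr 2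
    push_cast
    ring
  have h1 : ∀ s : ℤ, a s * bspline (n + 1) (y - s) = ((2 : ℝ) ^ n)⁻¹ *
      ∑ j ∈ Finset.range (n + 2), ((n + 1).choose j : ℝ) *
        (a s * bspline (n + 1) (2 * (y - s) - j)) := fun s => by
    rw [bspline_refine, mul_left_comm, Finset.mul_sum]
    simp only [mul_left_comm]
  have h2 : ∀ s : ℤ, refinedCoef (n + 1) a s * bspline (n + 1) (2 * y - s) = ((2 : ℝ) ^ n)⁻¹ *
      ∑ j ∈ Finset.range (n + 2), ((n + 1).choose j : ℝ) *
        (g j s * bspline (n + 1) (2 * y - s)) := fun s => by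
    rw [refinedCoef, mul_assoc, Finset.sum_mul]
    simp only [mul_assoc, g, Nat.add_sub_cancel]
  simp only [h1, h2]
  rw [tsum_mul_left, tsum_mul_left, Summable.tsum_finsetSum fun j _ => (hs' j).mul_left _,
    Summable.tsum_finsetSum fun j _ => (summable_mul_bspline _ _ _).mul_left _]
  simp only [tsum_mul_left, hj]

theorem shiftOp_two_scale_aux (ℓ μ : ℕ) (lam : ℤ → ℝ) {ι : Type*} (t : Finset ι) (c : ι → ℝ)
    (e : ι → ℤ) (h : ℝ) (φ : ℝ → ℝ) (x : ℝ) :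
    shiftOp (LaurentPolynomial.C ((2 : ℝ) ^ (1 - (ℓ : ℤ))) * PLamSq ℓ μ lam *
        ∑ j ∈ t, LaurentPolynomial.C (c j) * LaurentPolynomial.T (e j)) h φ x
      = (2 : ℝ) ^ (1 - (ℓ : ℤ)) * ∑ j ∈ t, c j *
          shiftOp (PLam ℓ μ lam) (2 * h) φ (x + e j * h) := by
  rw [PLamSq, PLam, Finset.mul_sum, Finset.mul_sum, shiftOp_sum, Finset.mul_sum]
  refine Finset.sum_congr rfl fun j _ => ?_
  rw [Finset.sum_mul, shiftOp_sum, shiftOp_sum, Finset.mul_sum, Finset.mul_sum]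
  refine Finset.sum_congr rfl fun i _ => ?_
  have : ∀ (a b c : ℝ) (m n : ℤ), LaurentPolynomial.C a * (LaurentPolynomial.C b *
      LaurentPolynomial.T m) * (LaurentPolynomial.C c * LaurentPolynomial.T n)
      = LaurentPolynomial.C (a * b * c) * LaurentPolynomial.T (m + n) := fun a b c m n => by
    rw [map_mul, map_mul, LaurentPolynomial.T_add]; ring
  rw [this, shiftOp_C_mul_T, shiftOp_C_mul_T]
  have hx : x + ((2 * (i + (ℓ : ℤ) / 2) + e j : ℤ) : ℝ) * h
      = x + e j * h + ((i + (ℓ : ℤ) / 2 : ℤ) : ℝ) * (2 * h) := by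
    push_cast; ring
  rw [hx]
  ring

theorem refinedCoef_acoef {ℓ μ : ℕ} (hℓe : Even ℓ) (hℓ : 0 < ℓ) {lam : ℤ → ℝ}
    (hlam : IsEvenSeq lam) (k : ℕ) (φ : ℝ → ℝ) (s : ℤ) :
    refinedCoef ℓ (fun r => acoef ℓ μ lam k r φ) s
      = shiftOp (if Even s then PevenAux ℓ μ lam else PoddAux ℓ μ lam) (hstep ℓ (k + 1)) φ
          (s * hstep ℓ (k + 1)) := by
  have hpow : ((2 : ℝ) ^ (ℓ - 1))⁻¹ = (2 : ℝ) ^ (1 - (ℓ : ℤ)) := by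
    rw [← zpow_natCast, ← zpow_neg]
    congr 1
    omega
  have hsh : ∀ e : ℤ, Even (s - e) → shiftOp (PLam ℓ μ lam) (hstep ℓ k) φ
      (((s - e) / 2 : ℤ) * hstep ℓ k)
      = shiftOp (PLam ℓ μ lam) (2 * hstep ℓ (k + 1)) φ
        (s * hstep ℓ (k + 1) + ((-e : ℤ) : ℝ) * hstep ℓ (k + 1)) := by
    rintro e ⟨t, ht⟩
    rw [two_mul_hstep_succ, ← two_mul_hstep_succ ℓ k]
    congr 1
    have h1 : (s - e) / 2 = t := by omega
    have h2 : s = e + t + t := by omega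
    rw [h1, h2]
    push_cast
    ring
  obtain ⟨m, hm⟩ := hℓe
  have h2m : ℓ / 2 = m := by omega
  unfold refinedCoef
  simp only [acoef_eq_shiftOp ⟨m, hm⟩ hlam]
  rw [show ℓ + 1 = 2 * m + 1 by omega, sum_range_even_add_odd, hpow]
  by_cases hs : Even s
  · rw [if_pos hs, PevenAux, shiftOp_two_scale_aux, h2m,
      Finset.sum_eq_zero (s := Finset.range m), add_zero]
    · congr 1
      refine Finset.sum_congr rfl fun i _ => ?_
      have he : Even (s - ((2 * i : ℕ) : ℤ)) := by
        rw [Int.even_sub]; simp [hs]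
      rw [if_pos he, hsh _ he]
      push_cast
      rfl
    · intro i _
      rw [if_neg, mul_zero]
      rw [Int.even_sub]
      simp [hs, parity_simps]
  · rw [if_neg hs, PoddAux, shiftOp_two_scale_aux, h2m,
      Finset.sum_eq_zero (s := Finset.range (m + 1)), zero_add]
    · congr 1
      refine Finset.sum_congr rfl fun i _ => ?_
      have he : Even (s - ((2 * i + 1 : ℕ) : ℤ)) := by
        rw [Int.even_sub]; simp [hs, parity_simps]
      rw [if_pos he, hsh _ he]
      congr 4
      push_cast
      ring
    · intro i _
      rw [if_neg, mul_zero]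
      rw [Int.even_sub]
      simp [hs]

theorem shiftOp_hstep_periodic {ℓ : ℕ} (hℓ : 0 < ℓ) (k : ℕ) {φ : ℝ → ℝ}
    (hφ : Function.Periodic φ 1) (P : LaurentPolynomial ℝ) :
    Function.Periodic (fun s : ℤ => shiftOp P (hstep ℓ k) φ (s * hstep ℓ k))
      ((ℓ * 2 ^ k : ℕ) : ℤ) := by
  intro s
  simp only
  rw [Int.cast_add, add_mul, Int.cast_natCast, hstep_mul_cancel hℓ, shiftOp_periodic hφ]

theorem Qk_eq_sum {ℓ μ : ℕ} (hℓe : Even ℓ) (hℓ : 0 < ℓ) {lam : ℤ → ℝ}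
    (hlam : IsEvenSeq lam) (k : ℕ) {φ : ℝ → ℝ} (hφ : Function.Periodic φ 1) (y : ℝ) :
    Qk ℓ μ lam k φ y = ∑ r ∈ Finset.range (ℓ * 2 ^ k),
      shiftOp (PLam ℓ μ lam) (hstep ℓ k) φ (r * hstep ℓ k) * Nks ℓ k (r : ℤ) y := by
  unfold Qk
  simp only [acoef_eq_shiftOp hℓe hlam]
  rw [tsum_periodic_mul_bspline hℓ k (shiftOp_hstep_periodic hℓ k hφ _)]
  simp only [Int.cast_natCast]

theorem Qk_succ_sub_Qk {ℓ μ : ℕ} (hℓe : Even ℓ) (hℓ : 0 < ℓ) {lam : ℤ → ℝ}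
    (hlam : IsEvenSeq lam) (k : ℕ) {φ : ℝ → ℝ} (hφ : Function.Periodic φ 1) (y : ℝ) :
    Qk ℓ μ lam (k + 1) φ y - Qk ℓ μ lam k φ y = ∑ r ∈ Finset.range (ℓ * 2 ^ (k + 1)),
      shiftOp (if Even r then Peven ℓ μ lam else Podd ℓ μ lam) (hstep ℓ (k + 1)) φ
        (r * hstep ℓ (k + 1)) * Nks ℓ (k + 1) (r : ℤ) y := by
  have h2 : 2 * ((ℓ : ℝ) * 2 ^ k * y) = (ℓ : ℝ) * 2 ^ (k + 1) * y := by ring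
  unfold Qk
  rw [tsum_refine hℓ (fun s => acoef ℓ μ lam k s φ), h2,
    ← Summable.tsum_sub (summable_mul_bspline _ _ _) (summable_mul_bspline _ _ _)]
  have hc : ∀ s : ℤ, acoef ℓ μ lam (k + 1) s φ * bspline ℓ ((ℓ : ℝ) * 2 ^ (k + 1) * y - s)
      - refinedCoef ℓ (fun s => acoef ℓ μ lam k s φ) s *
        bspline ℓ ((ℓ : ℝ) * 2 ^ (k + 1) * y - s)
      = shiftOp (if Even s then Peven ℓ μ lam else Podd ℓ μ lam) (hstep ℓ (k + 1)) φ
        (s * hstep ℓ (k + 1)) * bspline ℓ ((ℓ : ℝ) * 2 ^ (k + 1) * y - s) := fun s => by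
    rw [← sub_mul, refinedCoef_acoef hℓe hℓ hlam, acoef_eq_shiftOp hℓe hlam, ← shiftOp_sub]
    split_ifs <;> rfl
  simp only [hc]
  rw [tsum_periodic_mul_bspline hℓ (k + 1) (b := fun s : ℤ =>
    shiftOp (if Even s then Peven ℓ μ lam else Podd ℓ μ lam) (hstep ℓ (k + 1)) φ
      (s * hstep ℓ (k + 1)))]
  · simp only [Int.cast_natCast, Int.even_coe_nat]
  · intro s
    have he : Even (s + ((ℓ * 2 ^ (k + 1) : ℕ) : ℤ)) ↔ Even s := by
      have : Even ((ℓ * 2 ^ (k + 1) : ℕ) : ℤ) := (Int.even_coe_nat _).2 (hℓe.mul_right _)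
      rw [Int.even_add]; simp only [this, iff_true]
    simp only [he]
    exact shiftOp_hstep_periodic hℓ (k + 1) hφ _ s

theorem qdiffCoord_eq_samplingCoord {ℓ μ d : ℕ} (hℓe : Even ℓ) (hℓ : 0 < ℓ) {lam : ℤ → ℝ}
    (hlam : IsEvenSeq lam) (j : Fin d) (k : ℕ) {g : (Fin d → ℝ) → ℝ}
    (hg : ∀ x : Fin d → ℝ, g (Function.update x j (x j + 1)) = g x) :
    qdiffCoord ℓ μ lam j k g = samplingCoord (ℓ * 2 ^ k)
      (fun s => if k = 0 then PLam ℓ μ lam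
        else if Even s then Peven ℓ μ lam else Podd ℓ μ lam)
      (hstep ℓ k) (fun s => Nks ℓ k (s : ℤ)) j g := by
  ext x
  have hφ : Function.Periodic (fun t => g (Function.update x j t)) 1 := fun t => by
    simpa using hg (Function.update x j t)
  cases k with
  | zero => exact Qk_eq_sum hℓe hℓ hlam 0 hφ (x j)
  | succ k => exact Qk_succ_sub_Qk hℓe hℓ hlam k hφ (x j)

/-- multivariate coefficient formula: for `𝐤` supported exactly on `u`
(`k_j > 0` iff `j ∈ u`), `q_𝐤(f) = Σ_{𝐬∈I(𝐤)} c_{𝐤,𝐬}(f) N_{𝐤,𝐬}` with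
`c_{𝐤,𝐬}(f) = T_{𝐡^{(𝐤)}}^{[P_{𝐤,𝐬}]}(f)(𝐬𝐡^{(𝐤)})`, where `P_{𝐤,𝐬}` is the
tensor product of `P_Λ(z_j)` for `j ∉ u` and `P*_{k_j,s_j}(z_j)(z_j-1)^ℓ` for `j ∈ u`. -/
theorem coefficient_formula_multivariate (ℓ μ d : ℕ) (hℓe : Even ℓ) (hℓ : 0 < ℓ)
    (hd : 0 < d) (hμ : ℓ/2 - 1 ≤ μ) (lam : ℤ → ℝ) (hlam : IsEvenSeq lam)
    (hQI : IsQuasiInterp ℓ μ lam) (Pe Po : LaurentPolynomial ℝ)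
    (hPe : Peven ℓ μ lam = (LaurentPolynomial.T 1 - 1) ^ ℓ * Pe)
    (hPo : Podd ℓ μ lam = (LaurentPolynomial.T 1 - 1) ^ ℓ * Po)
    (u : Finset (Fin d)) (k : Fin d → ℕ) (hk : ∀ j, j ∈ u ↔ 0 < k j)
    (f : (Fin d → ℝ) → ℝ) (hfc : Continuous f) (hfp : PeriodicTd f) (x : Fin d → ℝ) :
    qmix ℓ μ lam k f x
      = ∑ s ∈ Fintype.piFinset (fun j => Finset.range (ℓ * 2 ^ (k j))),
          tensorShift
            (fun j => if k j = 0 then PLam ℓ μ lam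
              else (if Even (s j) then Pe else Po) * (LaurentPolynomial.T 1 - 1) ^ ℓ)
            (fun j => hstep ℓ (k j)) f (fun j => (s j : ℝ) * hstep ℓ (k j))
          * ∏ j, Nks ℓ (k j) (s j : ℤ) (x j) := by
  have h := foldr_eq_foldr_samplingCoord (fun j => ℓ * 2 ^ k j)
    (fun j s => if k j = 0 then PLam ℓ μ lam
        else if Even s then Peven ℓ μ lam else Podd ℓ μ lam)
    (fun j => hstep ℓ (k j)) (fun j s => Nks ℓ (k j) (s : ℤ))
    (fun j => qdiffCoord ℓ μ lam j (k j))
    (fun j g hg => qdiffCoord_eq_samplingCoord hℓe hℓ hlam j (k j) hg) hfp (List.nodup_finRange d)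
  unfold qmix
  rw [h.1, foldr_samplingCoord]
  simp only [hPe, hPo, ite_mul, mul_comm (_ ^ ℓ)]
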